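/- Let X be an infinite set equipped with the Fort topology with particular point b ∈ X, and let C, D be nonempty subsets of X. Then C can be embedded into D if and only if (C is finite or b ∉ C \ D) and card(C) ≤ card(D). -/

import Mathlib

open Cardinal Set Filter

universe u v

/-- The topology on `α` is the Fort topology with particular point `b`. -/
def IsFort {α : Type*} [TopologicalSpace α] (b : α) : Prop :=
  ∀ U : Set α, IsOpen U ↔ b ∉ U ∨ (Uᶜ : Set α).Finite

/-- `S ≈ T` : the subspaces `S` and `T` are homeomorphic. -/
def Homeo {α : Type*} [TopologicalSpace α] (S T : Set α) : Prop :=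
  Nonempty (S ≃ₜ T)

/-- `C` can be embedded into `D`: there is `E ⊆ D` with `E ≈ C`. -/
def CanEmbed {α : Type*} [TopologicalSpace α] (C D : Set α) : Prop :=
  ∃ E : Set α, E ⊆ D ∧ Homeo E C

/-- `A` is a `C-(X,D,lam)` Top-design of type 1. -/
def IsTopDesign1 {X : Type u} [TopologicalSpace X] (C D : Set X)
    (lam : Cardinal.{u}) (A : Set (Set X)) : Prop :=
  (∀ B ∈ A, Homeo B D ∧ Homeo (Bᶜ : Set X) (Dᶜ : Set X)) ∧
  ∀ E : Set X, Homeo E C → #↥{B ∈ A | E ⊆ B} = lam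

/-- `A` is a `C-(X,D,lam)` Top-design of type 2. -/
def IsTopDesign2 {X : Type u} [TopologicalSpace X] (C D : Set X)
    (lam : Cardinal.{u}) (A : Set (Set X)) : Prop :=
  (∀ B ∈ A, Homeo B D) ∧
  ∀ E : Set X, Homeo E C → #↥{B ∈ A | E ⊆ B} = lam

/-- `A` is a `C-(X,D,lam)` Top-design of type 3. -/
def IsTopDesign3 {X : Type u} [TopologicalSpace X] (C D : Set X)
    (lam : Cardinal.{u}) (A : Set (Set X)) : Prop :=
  (∀ B ∈ A, Homeo B D ∧ Homeo (Bᶜ : Set X) (Dᶜ : Set X)) ∧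
  ∀ E : Set X, Homeo E C → Homeo (Eᶜ : Set X) (Cᶜ : Set X) →
    #↥{B ∈ A | E ⊆ B} = lam

/-- `A` is a `C-(X,D,lam)` Top-design of type 4. -/
def IsTopDesign4 {X : Type u} [TopologicalSpace X] (C D : Set X)
    (lam : Cardinal.{u}) (A : Set (Set X)) : Prop :=
  (∀ B ∈ A, Homeo B D) ∧
  ∀ E : Set X, Homeo E C → Homeo (Eᶜ : Set X) (Cᶜ : Set X) →
    #↥{B ∈ A | E ⊆ B} = lam

theorem IsFort.isOpen_subtype_iff {X : Type*} [TopologicalSpace X] {b : X} (hX : IsFort b)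
    {C : Set X} {s : Set C} : IsOpen s ↔ (∀ x ∈ s, (x : X) ≠ b) ∨ sᶜ.Finite := by
  rw [isOpen_induced_iff]
  constructor
  · rintro ⟨t, ht, rfl⟩
    rcases (hX t).1 ht with h | h
    · exact Or.inl fun x hx hxb => h (hxb ▸ hx)
    · exact Or.inr (h.preimage Subtype.val_injective.injOn)
  · rintro (h | h)
    · refine ⟨Subtype.val '' s, (hX _).2 (Or.inl ?_),
        preimage_image_eq s Subtype.val_injective⟩
      rintro ⟨x, hx, hxb⟩
      exact h x hx hxb
    · refine ⟨(Subtype.val '' sᶜ)ᶜ, (hX _).2 (Or.inr ?_), ?_⟩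
      · rw [compl_compl]
        exact h.image _
      · rw [preimage_compl, preimage_image_eq _ Subtype.val_injective, compl_compl]

theorem IsFort.homeo_of_equiv {X : Type*} [TopologicalSpace X] {b : X} (hX : IsFort b)
    {C E : Set X} (e : C ≃ E) (he : C.Finite ∨ ∀ x, (e x : X) = b ↔ (x : X) = b) :
    Homeo E C := by
  refine ⟨(e.toHomeomorph fun s => ?_).symm⟩
  rw [hX.isOpen_subtype_iff, hX.isOpen_subtype_iff, ← preimage_compl,
    ← e.image_symm_eq_preimage sᶜ, finite_image_iff e.symm.injective.injOn]
  rcases he with hC | he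
  · have : Finite C := hC
    have : Finite E := .of_equiv C e
    exact iff_of_true (Or.inr (toFinite _)) (Or.inr (toFinite _))
  · refine or_congr_left ⟨fun h y hy => ?_, fun h x hx hxb => h (e x) hx ((he x).2 hxb)⟩
    obtain ⟨x, rfl⟩ := e.surjective y
    exact fun hxb => h x hy ((he x).1 hxb)

theorem IsFort.canEmbed_of_injective {X : Type*} [TopologicalSpace X] {b : X} (hX : IsFort b)
    {C D : Set X} {f : C → X} (hf : f.Injective) (hfD : ∀ x, f x ∈ D)
    (hfb : C.Finite ∨ ∀ x, f x = b ↔ (x : X) = b) : CanEmbed C D :=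
  ⟨range f, range_subset_iff.2 hfD, hX.homeo_of_equiv (Equiv.ofInjective f hf) hfb⟩

theorem exists_injective_forall_mem_ne {X : Type u} (b : X) {C D : Set X} (hC : C.Infinite)
    (h : #C ≤ #D) : ∃ g : C → X, g.Injective ∧ ∀ x, g x ∈ D ∧ g x ≠ b := by
  have hD : ℵ₀ ≤ #D := (infinite_coe_iff.2 hC |> aleph0_le_mk_iff.2).trans h
  have hDb : #D ≤ #↥(D \ {b}) := by
    have hle : #D ≤ #↥(D \ {b}) + 1 := by
      simpa using (mk_le_mk_of_subset (subset_sdiff_union D {b})).trans (mk_union_le _ _)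
    by_contra! hlt
    exact (hle.trans_lt (add_lt_of_lt hD hlt (one_lt_aleph0.trans_le hD))).false
  obtain ⟨g⟩ := h.trans hDb
  exact ⟨fun x => g x, Subtype.val_injective.comp g.injective, fun x => (g x).2⟩

theorem canEmbed_iff {X : Type u} [TopologicalSpace X] [Infinite X]
    (b : X) (hX : IsFort b) (C D : Set X) (hC : C.Nonempty) (hD : D.Nonempty) :
    CanEmbed C D ↔ (C.Finite ∨ b ∉ C \ D) ∧ #↥C ≤ #↥D := by
  constructor
  · rintro ⟨E, hED, ⟨e⟩⟩
    refine ⟨?_, (mk_congr e.toEquiv).symm.le.trans (mk_le_mk_of_subset hED)⟩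
    rw [or_iff_not_imp_right, not_not]
    rintro ⟨hbC, hbD⟩
    have hopen : IsOpen ({⟨b, hbC⟩} : Set C) := by
      rw [← e.isOpen_preimage, hX.isOpen_subtype_iff]
      exact Or.inl fun x _ hxb => hbD (hxb ▸ hED x.2)
    rcases hX.isOpen_subtype_iff.1 hopen with h | h
    · exact absurd rfl (h _ rfl)
    · exact finite_coe_iff.1 (finite_univ_iff.1 (compl_union_self _ ▸ h.union (finite_singleton _)))
  · rintro ⟨hb, hcard⟩
    by_cases hfin : C.Finite
    · obtain ⟨g⟩ := hcard
      exact hX.canEmbed_of_injective (Subtype.val_injective.comp g.injective)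
        (fun x => (g x).2) (Or.inl hfin)
    · have hbD : b ∈ C → b ∈ D := by simpa [hfin] using hb
      obtain ⟨g, hg, hgD⟩ := exists_injective_forall_mem_ne b hfin hcard
      classical
      refine hX.canEmbed_of_injective (f := fun x => if (x : X) = b then b else g x)
        (fun x y hxy => ?_) (fun x => ?_) (Or.inr fun x => ?_)
      · have hx := (hgD x).2
        have hy := (hgD y).2
        dsimp only at hxy
        split_ifs at hxy with h₁ h₂ h₂
        · exact Subtype.ext (h₁.trans h₂.symm)
        · exact absurd hxy.symm hy
        · exact absurd hxy hx
        · exact hg hxy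
      · split_ifs with h
        · exact hbD (h ▸ x.2)
        · exact (hgD x).1
      · simp [(hgD x).2]
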